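/- Mixed product identity for rectangular matrices: for all A, B ∈ ℝ^{m×n} and all C, D ∈ ℝ^{n×p}, (A ⊗ₛ B)(C ⊗ₛ D) = ½ (AC ⊗ₛ BD + AD ⊗ₛ BC), an identity in ℝ^{m̄ × p̄}. -/

import Mathlib

open Matrix

noncomputable section

/-- `n̄ = n(n+1)/2`, the dimension of the space of symmetric `n × n` matrices. -/
def triDim (n : ℕ) : ℕ := n * (n + 1) / 2

/-- The (0-based) row/column pair `(r(j), c(j))` of the `j`-th position in the
lexicographic (left-to-right, top-to-bottom) enumeration of the on-or-above-diagonal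
positions of an `n × n` matrix. -/
def rcPair : ℕ → ℕ → ℕ × ℕ
  | 0, _ => (0, 0)
  | (m + 1), j =>
      if j < m + 1 then (0, j)
      else ((rcPair m (j - (m + 1))).1 + 1, (rcPair m (j - (m + 1))).2 + 1)

/-- The orthonormal basis `E_j` of the space of symmetric `n × n` matrices:
`E_j = e_{r(j)} e_{c(j)}ᵀ` if `r(j) = c(j)`, and
`E_j = (√2/2) (e_{r(j)} e_{c(j)}ᵀ + e_{c(j)} e_{r(j)}ᵀ)` if `r(j) < c(j)`. -/
def symBasis (n : ℕ) (j : Fin (triDim n)) : Matrix (Fin n) (Fin n) ℝ :=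
  if (rcPair n j).1 = (rcPair n j).2 then
    Matrix.of fun a b : Fin n =>
      if (a : ℕ) = (rcPair n j).1 ∧ (b : ℕ) = (rcPair n j).2 then (1 : ℝ) else 0
  else
    Matrix.of fun a b : Fin n =>
      if ((a : ℕ) = (rcPair n j).1 ∧ (b : ℕ) = (rcPair n j).2) ∨
          ((a : ℕ) = (rcPair n j).2 ∧ (b : ℕ) = (rcPair n j).1) then
        Real.sqrt 2 / 2
      else 0

/-- Column-stacking vectorization `vec : ℝ^{m×n} → ℝ^{nm}`: `vec(A)_{j·m + i} = A_{i,j}`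
(0-based), realized through `finProdFinEquiv (j, i) = j * m + i`. -/
def mvec {m n : ℕ} (A : Matrix (Fin m) (Fin n) ℝ) : Fin (n * m) → ℝ :=
  fun k => A (finProdFinEquiv.symm k).2 (finProdFinEquiv.symm k).1

/-- The matrix `W_n ∈ ℝ^{n̄ × n²}` whose `j`-th row is `vec(E_j)ᵀ`. -/
def Wmat (n : ℕ) : Matrix (Fin (triDim n)) (Fin (n * n)) ℝ :=
  Matrix.of fun j k => mvec (symBasis n j) k

/-- The Kronecker product on `Fin`-indexed matrices, with the standard flattening
`(A ⊗ B)_{(i·p + k, j·q + l)} = A_{i,j} B_{k,l}`. -/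
def kron {m n p q : ℕ} (A : Matrix (Fin m) (Fin n) ℝ) (B : Matrix (Fin p) (Fin q) ℝ) :
    Matrix (Fin (m * p)) (Fin (n * q)) ℝ :=
  Matrix.reindex finProdFinEquiv finProdFinEquiv (Matrix.kroneckerMap (· * ·) A B)

/-- The symmetric Kronecker product `A ⊗ₛ B = W_m (A ⊗ B) W_nᵀ ∈ ℝ^{m̄ × n̄}`
of rectangular matrices `A, B ∈ ℝ^{m×n}`. -/
def skron {m n : ℕ} (A B : Matrix (Fin m) (Fin n) ℝ) :
    Matrix (Fin (triDim m)) (Fin (triDim n)) ℝ :=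
  Wmat m * kron A B * (Wmat n)ᵀ

/-- The Frobenius inner product `⟨A, B⟩_F = trace(Aᵀ B)`. -/
def frobInner {m n : ℕ} (A B : Matrix (Fin m) (Fin n) ℝ) : ℝ :=
  (Aᵀ * B).trace

/-- Symmetric vectorization `svec(P)_j = ⟨P, E_j⟩_F`. -/
def svec {n : ℕ} (P : Matrix (Fin n) (Fin n) ℝ) : Fin (triDim n) → ℝ :=
  fun j => frobInner P (symBasis n j)

/-- The symmetric part `π(A) = (A + Aᵀ)/2`. -/
def symPart {n : ℕ} (A : Matrix (Fin n) (Fin n) ℝ) : Matrix (Fin n) (Fin n) ℝ :=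
  (1 / 2 : ℝ) • (A + Aᵀ)

/-- The symmetric Kronecker sum `A ⊕ₛ B = A ⊗ₛ I + I ⊗ₛ B`. -/
def skronSum {n : ℕ} (A B : Matrix (Fin n) (Fin n) ℝ) :
    Matrix (Fin (triDim n)) (Fin (triDim n)) ℝ :=
  skron A 1 + skron 1 B

/-- A vector `x ∈ ℝⁿ` regarded as an `n × 1` matrix. -/
def colVec {n : ℕ} (x : Fin n → ℝ) : Matrix (Fin n) (Fin 1) ℝ :=
  Matrix.of fun i _ => x i

theorem triDim_succ (n : ℕ) : triDim (n + 1) = (n + 1) + triDim n := by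
  unfold triDim
  rw [show (n + 1) * (n + 1 + 1) = n * (n + 1) + (n + 1) * 2 by ring,
    Nat.add_mul_div_right _ _ (by norm_num), add_comm]

/-- The positions `rcPair n j`, `j < n̄`, run exactly once through the pairs `r ≤ c < n`. -/
theorem sum_rcPair {M : Type*} [AddCommMonoid M] (n : ℕ) (g : ℕ → ℕ → M) :
    ∑ j ∈ Finset.range (triDim n), g (rcPair n j).1 (rcPair n j).2 =
      ∑ r ∈ Finset.range n, ∑ c ∈ Finset.range n, if r ≤ c then g r c else 0 := by
  induction n generalizing g with
  | zero => simp [triDim]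
  | succ n ih =>
    rw [triDim_succ, Finset.sum_range_add]
    conv_rhs => rw [Finset.sum_range_succ', add_comm]
    congr 1
    · refine Finset.sum_congr rfl fun j hj => ?_
      rw [rcPair, if_pos (Finset.mem_range.1 hj), if_pos (Nat.zero_le j)]
    · simp only [rcPair, show ∀ j, ¬ n + 1 + j < n + 1 by omega, if_false,
        Nat.add_sub_cancel_left]
      rw [ih fun r c => g (r + 1) (c + 1)]
      refine Finset.sum_congr rfl fun r _ => ?_
      rw [Finset.sum_range_succ']
      simp

/-- The value of the nonzero entries of the basis matrix supported at `(a, b)` and `(b, a)`. -/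
def symWeight (a b : ℕ) : ℝ := if a = b then 1 else Real.sqrt 2 / 2

theorem rcPair_fst_le_snd (n j : ℕ) : (rcPair n j).1 ≤ (rcPair n j).2 := by
  induction n generalizing j with
  | zero => simp [rcPair]
  | succ n ih =>
    rw [rcPair]
    split_ifs
    · exact Nat.zero_le _
    · exact Nat.succ_le_succ (ih _)

theorem symBasis_apply (n : ℕ) (j : Fin (triDim n)) (a b : Fin n) :
    symBasis n j a b =
      if (rcPair n j).1 = min (a : ℕ) b ∧ (rcPair n j).2 = max (a : ℕ) b
      then symWeight a b else 0 := by
  have h := rcPair_fst_le_snd n j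
  unfold symBasis symWeight
  split_ifs <;> simp only [of_apply] <;> split_ifs <;> first | rfl | omega

theorem symBasis_apply_comm (n : ℕ) (j : Fin (triDim n)) (a b : Fin n) :
    symBasis n j a b = symBasis n j b a := by
  simp only [symBasis_apply, symWeight, min_comm (a : ℕ), max_comm (a : ℕ), eq_comm (a := (a : ℕ))]

theorem sum_symBasis_mul_symBasis (n : ℕ) (a b c d : Fin n) :
    ∑ j, symBasis n j a b * symBasis n j c d =
      (1 / 2 : ℝ) * ((if a = c ∧ b = d then 1 else 0) + if a = d ∧ b = c then 1 else 0) := by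
  have ha := a.isLt
  have hb := b.isLt
  have hs : Real.sqrt 2 / 2 * (Real.sqrt 2 / 2) = 1 / 2 := by
    rw [div_mul_div_comm, Real.mul_self_sqrt (by norm_num)]; norm_num
  let g : ℕ → ℕ → ℝ := fun r s =>
    (if r = min (a : ℕ) b ∧ s = max (a : ℕ) b then symWeight a b else 0) *
      if r = min (c : ℕ) d ∧ s = max (c : ℕ) d then symWeight c d else 0
  have hg : ∀ j, symBasis n j a b * symBasis n j c d = g (rcPair n j).1 (rcPair n j).2 :=
    fun j => by rw [symBasis_apply, symBasis_apply]
  simp only [hg]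
  rw [Fin.sum_univ_eq_sum_range (fun j => g (rcPair n j).1 (rcPair n j).2), sum_rcPair,
    Finset.sum_eq_single_of_mem (min (a : ℕ) b) (Finset.mem_range.2 (by omega)),
    Finset.sum_eq_single_of_mem (max (a : ℕ) b) (Finset.mem_range.2 (by omega)),
    if_pos (by omega)]
  · simp only [g, symWeight, Fin.ext_iff, and_self, if_true]
    split_ifs <;> first | omega | linarith
  · intro s _ hs
    simp [g, hs]
  · intro r _ hr
    simp [g, hr]

/-- The commutation matrix, which exchanges the factors of a Kronecker product. -/
def commMat (n : ℕ) : Matrix (Fin (n * n)) (Fin (n * n)) ℝ :=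
  Matrix.reindex finProdFinEquiv finProdFinEquiv
    ((1 : Matrix (Fin n × Fin n) (Fin n × Fin n) ℝ).submatrix Prod.swap id)

theorem Wmat_transpose_mul_Wmat (n : ℕ) :
    (Wmat n)ᵀ * Wmat n = (1 / 2 : ℝ) • (1 + commMat n) := by
  ext x y
  obtain ⟨⟨b, a⟩, rfl⟩ := finProdFinEquiv.surjective x
  obtain ⟨⟨d, c⟩, rfl⟩ := finProdFinEquiv.surjective y
  simp only [mul_apply, transpose_apply, Wmat, mvec, of_apply, Equiv.symm_apply_apply,
    sum_symBasis_mul_symBasis]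
  simp [commMat, one_apply, and_comm]

theorem commMat_mul_kron {m n : ℕ} (A B : Matrix (Fin m) (Fin n) ℝ) :
    commMat m * kron A B = kron B A * commMat n := by
  simp only [commMat, kron, reindex_apply, submatrix_mul_equiv]
  congr 1
  ext ⟨a, b⟩ ⟨c, d⟩
  simp [mul_apply, one_apply, Fintype.sum_prod_type, ite_and, mul_comm]

theorem commMat_mul_Wmat_transpose (n : ℕ) : commMat n * (Wmat n)ᵀ = (Wmat n)ᵀ := by
  ext x j
  obtain ⟨⟨b, a⟩, rfl⟩ := finProdFinEquiv.surjective x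
  rw [mul_apply, ← finProdFinEquiv.sum_comp]
  simp only [commMat, reindex_apply, submatrix_apply, Equiv.symm_apply_apply, one_apply,
    transpose_apply, Wmat, mvec, of_apply, Prod.swap_prod_mk, id_eq, ite_mul, one_mul, zero_mul,
    Finset.sum_ite_eq, Finset.mem_univ, if_true]
  exact symBasis_apply_comm n j b a

theorem kron_mul_kron {m n p : ℕ} (A B : Matrix (Fin m) (Fin n) ℝ)
    (C D : Matrix (Fin n) (Fin p) ℝ) :
    kron A B * kron C D = kron (A * C) (B * D) := by
  simp only [kron, reindex_apply, submatrix_mul_equiv]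
  rw [← mul_kronecker_mul A C B D]

/-- mixed product identity for rectangular matrices:
`(A ⊗ₛ B)(C ⊗ₛ D) = ½ (AC ⊗ₛ BD + AD ⊗ₛ BC)`. -/
theorem skron_mixed_prod (m n p : ℕ) (A B : Matrix (Fin m) (Fin n) ℝ)
    (C D : Matrix (Fin n) (Fin p) ℝ) :
    skron A B * skron C D =
      (1 / 2 : ℝ) • (skron (A * C) (B * D) + skron (A * D) (B * C)) := by
  calc skron A B * skron C D
      = Wmat m * kron A B * ((Wmat n)ᵀ * Wmat n) * kron C D * (Wmat p)ᵀ := by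
        simp only [skron, Matrix.mul_assoc]
    _ = (1 / 2 : ℝ) • (Wmat m * (kron A B * kron C D) * (Wmat p)ᵀ +
          Wmat m * (kron A B * (commMat n * kron C D)) * (Wmat p)ᵀ) := by
        rw [Wmat_transpose_mul_Wmat]
        simp only [Matrix.mul_smul, Matrix.smul_mul, Matrix.mul_add, Matrix.add_mul,
          Matrix.mul_one, Matrix.mul_assoc]
    _ = _ := by
        rw [commMat_mul_kron, ← Matrix.mul_assoc (kron A B), kron_mul_kron, kron_mul_kron,
          ← Matrix.mul_assoc (Wmat m), Matrix.mul_assoc _ (commMat p),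
          commMat_mul_Wmat_transpose, skron, skron]
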